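/- Let f : Y → X be a morphism of projective geometrically irreducible varieties over a number field k, where X and Y are realized as closed subvarieties of projective spaces over k. Let U ⊆ X be a Zariski open set and let V = f⁻¹(U), and assume that the restriction f|_V : V → U is a finite morphism. If U is xeric, then V is xeric. -/

import Mathlib

noncomputable section

open MvPolynomial
open MvPolynomial

def vecHeight {K : Type} [Field K] [NumberField K] {N : ℕ} (x : Fin N → K) : ℝ :=
  (((FractionalIdeal.absNorm
        (∑ i, FractionalIdeal.spanSingleton
          (nonZeroDivisors (NumberField.RingOfIntegers K)) (x i)) : ℚ) : ℝ)⁻¹ *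
      ∏ w : NumberField.InfinitePlace K, (⨆ i, w (x i)) ^ w.mult) ^
    ((Module.finrank ℚ K : ℝ)⁻¹)

def projHeight {K : Type} [Field K] [NumberField K] {n : ℕ}
    (x : Projectivization K (Fin (n + 1) → K)) : ℝ :=
  vecHeight x.rep

/-! ### Projective zero loci, counting, sparsity -/

/-- The set of `L`-rational points of the Zariski closed subset of `ℙⁿ` cut out by the
set `S` of (homogeneous) polynomials with coefficients in `k`. -/
def projZeroLocus (k : Type) [CommRing k] {n : ℕ} (S : Set (MvPolynomial (Fin (n + 1)) k))
    (L : Type) [Field L] [Algebra k L] : Set (Projectivization L (Fin (n + 1) → L)) :=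
  {x | ∀ f ∈ S, eval x.rep (map (algebraMap k L) f) = 0}

/-- A set `S` of points (of projective space over a number field, say) is *sparse* with
respect to a height function `H` if for every `ε > 0` the number of points of `S` of
height at most `T` is `O_ε(T ^ ε)`. -/
def IsSparseWrt {P : Type} (S : Set P) (H : P → ℝ) : Prop :=
  ∀ ε : ℝ, 0 < ε → ∃ C : ℝ, 0 < C ∧ ∀ T : ℝ, 1 ≤ T →
    {x | x ∈ S ∧ H x ≤ T}.Finite ∧ ({x | x ∈ S ∧ H x ≤ T}.ncard : ℝ) ≤ C * T ^ ε

/-- Sparsity with respect to the standard projective Weil height. -/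
def IsSparse {L : Type} [Field L] [NumberField L] {n : ℕ}
    (S : Set (Projectivization L (Fin (n + 1) → L))) : Prop :=
  IsSparseWrt S projHeight

/-- The closed subset of `ℙⁿ` over a number field `k` cut out by `S` is *xeric* if its set
of `L`-rational points is sparse for every finite extension `L/k`. -/
def IsXeric (k : Type) [Field k] [NumberField k] {n : ℕ}
    (S : Set (MvPolynomial (Fin (n + 1)) k)) : Prop :=
  ∀ (L : Type) [Field L] [NumberField L] [Algebra k L] [FiniteDimensional k L],
    IsSparse (projZeroLocus k S L)

/-! ### Geometric irreducibility and smoothness, via equations -/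

/-- The closed subvariety of `ℙⁿ` cut out by `S` is geometrically integral (a
"geometrically irreducible variety"), expressed over a given algebraically closed
extension `K` of the ground field: the radical of the homogeneous ideal generated by `S`
is prime, and the corresponding cone has a nonzero point. -/
def GeomIntegralOver (k K : Type) [Field k] [Field K] [Algebra k K] {n : ℕ}
    (S : Set (MvPolynomial (Fin (n + 1)) k)) : Prop :=
  (Ideal.span ((map (algebraMap k K)) '' S)).radical.IsPrime ∧
    ∃ x : Fin (n + 1) → K, x ≠ 0 ∧ ∀ f ∈ S, eval x (map (algebraMap k K) f) = 0

/-- Smoothness (of pure dimension `d`) of the closed subvariety of `ℙⁿ` cut out by `S`,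
via the Jacobian criterion: at every nonzero point `x` of the affine cone over an
algebraically closed extension `K`, the space spanned by the gradients of the elements of
the homogeneous ideal of `X` has rank `n - d`. -/
def SmoothOfDimOver (k K : Type) [Field k] [Field K] [Algebra k K] {n : ℕ}
    (S : Set (MvPolynomial (Fin (n + 1)) k)) (d : ℕ) : Prop :=
  ∀ x : Fin (n + 1) → K, x ≠ 0 →
    (∀ f ∈ S, eval x (map (algebraMap k K) f) = 0) →
    Module.finrank K
      (Submodule.span K
        {g : Fin (n + 1) → K |
          ∃ f ∈ Ideal.span ((map (algebraMap k K)) '' S),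
            g = fun j => eval x (pderiv j f)}) = n - d
open MvPolynomial

/-! ### Morphisms of projective varieties, given by finitely many polynomial charts -/

/-- Data describing a morphism from a closed subvariety of `ℙᵐ` to `ℙⁿ`: finitely many
"charts", each of which is an `(n+1)`-tuple of homogeneous polynomials of a common
degree in the `m+1` homogeneous coordinates. -/
structure ChartMap (k : Type) [CommRing k] (m n : ℕ) where
  numCharts : ℕ
  F : Fin numCharts → Fin (n + 1) → MvPolynomial (Fin (m + 1)) k
  deg : Fin numCharts → ℕ
  homog : ∀ c i, (F c i).IsHomogeneous (deg c)

/-- Evaluation of the chart `c` of a `ChartMap` on a coordinate vector with entries in a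
`k`-algebra `A`. -/
def ChartMap.evalVec {k : Type} [CommRing k] {m n : ℕ} (Φ : ChartMap k m n)
    {A : Type} [CommRing A] [Algebra k A] (c : Fin Φ.numCharts) (y : Fin (m + 1) → A) :
    Fin (n + 1) → A :=
  fun i => eval y (map (algebraMap k A) (Φ.F c i))

/-- Base change of the polynomial data of a chart map along `k → K`. -/
def ChartMap.baseChange {k K : Type} [CommRing k] [CommRing K] [Algebra k K] {m n : ℕ}
    (Φ : ChartMap k m n) : ChartMap K m n where
  numCharts := Φ.numCharts
  F := fun c i => map (algebraMap k K) (Φ.F c i)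
  deg := Φ.deg
  homog := fun c i => (Φ.homog c i).map _

/-- The `A`-points of the closed subscheme of `ℙⁿ` cut out by `S`, for a (local)
`k`-algebra `A`, described by coordinate vectors: vectors, one of whose coordinates is a
unit, on which all the equations vanish.  (Two such vectors describe the same `A`-point
iff they differ by a unit scalar, see `unitEquiv`.) -/
def ringPoints (k : Type) [CommRing k] {n : ℕ} (S : Set (MvPolynomial (Fin (n + 1)) k))
    (A : Type) [CommRing A] [Algebra k A] : Set (Fin (n + 1) → A) :=
  {a | (∃ i, IsUnit (a i)) ∧ ∀ f ∈ S, eval a (map (algebraMap k A) f) = 0}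

/-- Two coordinate vectors describe the same point iff they differ by a unit scalar. -/
def unitEquiv {A : Type} [CommRing A] {N : ℕ} (a b : Fin N → A) : Prop :=
  ∃ u : Aˣ, b = fun i => (u : A) * a i

/-- The property that the chart data `Φ` defines a morphism from the closed subvariety
`Y ⊆ ℙᵐ` cut out by `SY` to the closed subvariety `X ⊆ ℙⁿ` cut out by `SX`:  on the
points of `Y` with values in any local `k`-algebra `A`, some chart is defined (has a unit
coordinate), any two defined charts agree up to a unit scalar, and the image satisfies
the equations of `X`.  (The functor of points on local rings determines a morphism of
  schemes, and every morphism of quasi-projective varieties arises this way.) -/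
structure IsChartMorphism (k : Type) [Field k] {m n : ℕ} (Φ : ChartMap k m n)
    (SY : Set (MvPolynomial (Fin (m + 1)) k)) (SX : Set (MvPolynomial (Fin (n + 1)) k)) :
    Prop where
  total : ∀ (A : Type) [CommRing A] [IsLocalRing A] [Algebra k A],
    ∀ a ∈ ringPoints k SY A, ∃ c i, IsUnit (Φ.evalVec c a i)
  compat : ∀ (A : Type) [CommRing A] [IsLocalRing A] [Algebra k A],
    ∀ a ∈ ringPoints k SY A, ∀ c c', (∃ i, IsUnit (Φ.evalVec c a i)) →
      (∃ i, IsUnit (Φ.evalVec c' a i)) → unitEquiv (Φ.evalVec c a) (Φ.evalVec c' a)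
  mapsInto : ∀ (A : Type) [CommRing A] [IsLocalRing A] [Algebra k A],
    ∀ a ∈ ringPoints k SY A, ∀ c, (∃ i, IsUnit (Φ.evalVec c a i)) →
      Φ.evalVec c a ∈ ringPoints k SX A

/-- The graph of the map induced by the chart data `Φ` on projective points over a field
`L`: `z` is the image of `x` if some chart of `Φ` is nonzero at (a representative of) `x`
and `z` is the corresponding projective point. -/
def chartImage {k L : Type} [Field k] [Field L] [Algebra k L] {m n : ℕ}
    (Φ : ChartMap k m n) (x : Projectivization L (Fin (m + 1) → L))
    (z : Projectivization L (Fin (n + 1) → L)) : Prop :=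
  ∃ c, ∃ h : Φ.evalVec c x.rep ≠ 0, z = Projectivization.mk L (Φ.evalVec c x.rep) h

/-! ### Finite étale morphisms, concretely -/

/-- The set of coordinate vectors of `A`-points of `Y` lying (up to a unit scalar, as
they must) over the `A`-point of `X` with coordinate vector `b`, under the map given by
the chart data `Φ`. -/
def fiberOver (k : Type) [Field k] {m n : ℕ} (Φ : ChartMap k m n)
    (SY : Set (MvPolynomial (Fin (m + 1)) k)) (A : Type) [CommRing A] [Algebra k A]
    (b : Fin (n + 1) → A) : Set (Fin (m + 1) → A) :=
  {a | a ∈ ringPoints k SY A ∧ ∃ c, (∃ i, IsUnit (Φ.evalVec c a i)) ∧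
    unitEquiv (Φ.evalVec c a) b}

/-- A set of coordinate vectors contains exactly `d` points up to unit scaling. -/
def HasExactlyPoints {A : Type} [CommRing A] {N : ℕ} (s : Set (Fin N → A)) (d : ℕ) :
    Prop :=
  ∃ r : Fin d → (Fin N → A), (∀ j, r j ∈ s) ∧
    (∀ j j', unitEquiv (r j) (r j') → j = j') ∧ ∀ a ∈ s, ∃ j, unitEquiv a (r j)

/-- The morphism `Y → X` given by the chart data `Φ` is finite étale of degree `d`:
over every point of `X` with values in a local Artinian `k`-algebra with algebraically
closed residue field, the fiber consists of exactly `d` points.  (For a morphism of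
projective varieties over a field of characteristic `0` this characterizes finite étale
morphisms of degree `d`.) -/
def IsFiniteEtaleOfDegree (k : Type) [Field k] {m n : ℕ} (Φ : ChartMap k m n)
    (SY : Set (MvPolynomial (Fin (m + 1)) k)) (SX : Set (MvPolynomial (Fin (n + 1)) k))
    (d : ℕ) : Prop :=
  ∀ (A : Type) [CommRing A] [IsLocalRing A] [IsArtinianRing A] [Algebra k A],
    IsAlgClosed (IsLocalRing.ResidueField A) →
    ∀ b ∈ ringPoints k SX A, HasExactlyPoints (fiberOver k Φ SY A b) d

/-- Finite étale (of some positive degree). -/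
def IsFiniteEtaleMor (k : Type) [Field k] {m n : ℕ} (Φ : ChartMap k m n)
    (SY : Set (MvPolynomial (Fin (m + 1)) k)) (SX : Set (MvPolynomial (Fin (n + 1)) k)) :
    Prop :=
  ∃ d : ℕ, 0 < d ∧ IsFiniteEtaleOfDegree k Φ SY SX d

/-! ### Rational curves -/

/-- Data for a morphism `ℙ¹ → ℙⁿ`: an `(n+1)`-tuple of binary forms of a common degree. -/
structure RatCurveData (K : Type) [CommRing K] (n : ℕ) where
  d : ℕ
  P : Fin (n + 1) → MvPolynomial (Fin 2) K
  homog : ∀ i, (P i).IsHomogeneous d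

/-- Evaluation of the tuple of binary forms at `(s, t)`. -/
def RatCurveData.evalAt {K : Type} [CommRing K] {n : ℕ} (Γ : RatCurveData K n)
    (s t : K) : Fin (n + 1) → K :=
  fun i => eval ![s, t] (Γ.P i)

/-- A subset `C` of `ℙⁿ(K)`, `K` algebraically closed, is a (possibly singular) rational
curve if it is the image of a non-constant morphism `ℙ¹ → ℙⁿ` (such an image is
automatically an integral closed curve). -/
def IsRationalCurve (K : Type) [Field K] {n : ℕ}
    (C : Set (Projectivization K (Fin (n + 1) → K))) : Prop :=
  ∃ Γ : RatCurveData K n,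
    (∀ s t : K, ¬(s = 0 ∧ t = 0) → Γ.evalAt s t ≠ 0) ∧
    (∃ s t s' t' : K, ¬(s = 0 ∧ t = 0) ∧ ¬(s' = 0 ∧ t' = 0) ∧
      ∀ u : K, Γ.evalAt s' t' ≠ u • Γ.evalAt s t) ∧
    C = {z | ∃ s t : K, ∃ h : Γ.evalAt s t ≠ 0, z = Projectivization.mk K (Γ.evalAt s t) h}

/-! ### Comparison of heights -/

section Height

variable {K : Type} [Field K] [NumberField K]

/-- The height of a coordinate vector relative to `K`, before taking the root of order
`[K : ℚ]`. -/
def relVecHeight {N : ℕ} (x : Fin N → K) : ℝ :=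
  (((FractionalIdeal.absNorm
        (∑ i, FractionalIdeal.spanSingleton
          (nonZeroDivisors (NumberField.RingOfIntegers K)) (x i)) : ℚ) : ℝ)⁻¹ *
      ∏ w : NumberField.InfinitePlace K, (⨆ i, w (x i)) ^ w.mult)

theorem relVecHeight_smul {N : ℕ} (x : Fin N → K) {c : K} (hc : c ≠ 0) :
    relVecHeight (c • x) = relVecHeight x := by
  have h1 : (∑ i, FractionalIdeal.spanSingleton
      (nonZeroDivisors (NumberField.RingOfIntegers K)) ((c • x) i)) =
      FractionalIdeal.spanSingleton (nonZeroDivisors (NumberField.RingOfIntegers K)) c *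
        ∑ i, FractionalIdeal.spanSingleton
          (nonZeroDivisors (NumberField.RingOfIntegers K)) (x i) := by
    rw [Finset.mul_sum]
    exact Finset.sum_congr rfl fun i _ => by
      rw [FractionalIdeal.spanSingleton_mul_spanSingleton, Pi.smul_apply, smul_eq_mul]
  have h2 (w : NumberField.InfinitePlace K) : (⨆ i, w ((c • x) i)) = w c * ⨆ i, w (x i) := by
    rw [Real.mul_iSup_of_nonneg (apply_nonneg w c)]
    simp
  have h3 : ((|Algebra.norm ℚ c| : ℚ) : ℝ) ≠ 0 := by
    simpa using hc
  unfold relVecHeight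
  simp_rw [h1, h2, mul_pow, Finset.prod_mul_distrib, NumberField.InfinitePlace.prod_eq_abs_norm,
    map_mul, FractionalIdeal.absNorm_span_singleton]
  rw [Rat.cast_mul, mul_inv, mul_mul_mul_comm, inv_mul_cancel₀ h3, one_mul]

theorem relVecHeight_eq_mulHeight {N : ℕ} {x : Fin N → K} (hx : x ≠ 0) :
    relVecHeight x = Height.mulHeight x := by
  obtain ⟨b, hb⟩ := IsLocalization.exist_integer_multiples_of_finite
    (nonZeroDivisors (NumberField.RingOfIntegers K)) x
  choose y hy using hb
  have hb0 : algebraMap (NumberField.RingOfIntegers K) K b ≠ 0 := by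
    simp
  have hyx : (fun i => (y i : K)) = algebraMap (NumberField.RingOfIntegers K) K b • x := by
    funext i
    rw [Pi.smul_apply, smul_eq_mul, ← Algebra.smul_def]
    exact hy i
  have hyK : (fun i => (y i : K)) ≠ 0 := by
    rw [hyx]
    exact smul_ne_zero hb0 hx
  have hy0 : y ≠ 0 := by
    rintro rfl
    exact hyK (by funext i; simp)
  have hI : (∑ i, FractionalIdeal.spanSingleton
      (nonZeroDivisors (NumberField.RingOfIntegers K)) (y i : K)) =
      ((Ideal.span (Set.range y) : Ideal (NumberField.RingOfIntegers K)) :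
        FractionalIdeal (nonZeroDivisors (NumberField.RingOfIntegers K)) K) := by
    rw [Ideal.span_range_eq_iSup, ← Finset.sup_univ_eq_iSup, ← Ideal.sum_eq_sup]
    change _ = FractionalIdeal.coeIdealHom _ K _
    rw [map_sum]
    exact Finset.sum_congr rfl fun i _ => (FractionalIdeal.coeIdeal_span_singleton _).symm
  rw [← relVecHeight_smul x hb0, ← Height.mulHeight_smul_eq_mulHeight x hb0, ← hyx,
    NumberField.mulHeight_eq hyK, mul_comm]
  unfold relVecHeight
  rw [hI, FractionalIdeal.coeIdeal_absNorm]
  congr 1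
  have := NumberField.absNorm_mul_finprod_finitePlace_eq_one hy0
  rw [Rat.cast_natCast]
  exact inv_eq_of_mul_eq_one_right this

theorem vecHeight_eq_mulHeight_rpow {N : ℕ} {x : Fin N → K} (hx : x ≠ 0) :
    vecHeight x = Height.mulHeight x ^ ((Module.finrank ℚ K : ℝ)⁻¹) := by
  rw [← relVecHeight_eq_mulHeight hx]
  rfl

theorem one_le_projHeight {n : ℕ} (x : Projectivization K (Fin (n + 1) → K)) :
    1 ≤ projHeight x := by
  rw [projHeight, vecHeight_eq_mulHeight_rpow x.rep_nonzero]
  exact Real.one_le_rpow (Height.one_le_mulHeight _) (by positivity)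

theorem projHeight_mk {n : ℕ} (v : Fin (n + 1) → K) (hv : v ≠ 0) :
    projHeight (Projectivization.mk K v hv) =
      Height.mulHeight v ^ ((Module.finrank ℚ K : ℝ)⁻¹) := by
  obtain ⟨a, ha⟩ := Projectivization.exists_smul_eq_mk_rep K v hv
  rw [projHeight, vecHeight_eq_mulHeight_rpow (Projectivization.rep_nonzero _), ← ha,
    Units.smul_def, Height.mulHeight_smul_eq_mulHeight _ a.ne_zero]

/-- The height of the image of a point under chart data is polynomially bounded in terms of the
height of the point. -/
theorem exists_projHeight_chartImage_le {k : Type} [Field k] [Algebra k K] {m n : ℕ}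
    (Φ : ChartMap k m n) :
    ∃ (C : ℝ) (D : ℕ), 1 ≤ C ∧ ∀ y x, chartImage (L := K) Φ y x →
      projHeight x ≤ C * projHeight y ^ D := by
  have hchart (c : Fin Φ.numCharts) : ∃ C : ℝ, 1 ≤ C ∧
      ∀ (y : Projectivization K (Fin (m + 1) → K)) (h : Φ.evalVec c y.rep ≠ 0),
        projHeight (Projectivization.mk K (Φ.evalVec c y.rep) h) ≤
          C * projHeight y ^ Φ.deg c := by
    obtain ⟨C, hC, hCle⟩ := Height.mulHeight_eval_le'
      (p := fun i => map (algebraMap k K) (Φ.F c i)) fun i => (Φ.homog c i).map _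
    refine ⟨max 1 (C ^ ((Module.finrank ℚ K : ℝ)⁻¹)), le_max_left _ _, fun y h => ?_⟩
    rw [projHeight_mk, projHeight, vecHeight_eq_mulHeight_rpow y.rep_nonzero]
    have hpos := Height.mulHeight_pos y.rep
    calc
      _ ≤ (C * Height.mulHeight y.rep ^ Φ.deg c) ^ ((Module.finrank ℚ K : ℝ)⁻¹) :=
        Real.rpow_le_rpow (Height.mulHeight_pos _).le (hCle y.rep) (by positivity)
      _ = C ^ ((Module.finrank ℚ K : ℝ)⁻¹) *
          (Height.mulHeight y.rep ^ ((Module.finrank ℚ K : ℝ)⁻¹)) ^ Φ.deg c := by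
        rw [Real.mul_rpow hC.le (by positivity), Real.rpow_pow_comm hpos.le]
      _ ≤ _ := by
        gcongr
        exact le_max_right _ _
  choose C hC hCle using hchart
  refine ⟨1 + ∑ c, C c, ∑ c, Φ.deg c, ?_, ?_⟩
  · have : 0 ≤ ∑ c, C c := Finset.sum_nonneg fun c _ => zero_le_one.trans (hC c)
    linarith
  · rintro y _ ⟨c, h, rfl⟩
    have hCc : C c ≤ 1 + ∑ c, C c := by
      have := Finset.single_le_sum (fun c _ => zero_le_one.trans (hC c)) (Finset.mem_univ c)
      linarith
    have hd : Φ.deg c ≤ ∑ c, Φ.deg c :=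
      Finset.single_le_sum (fun _ _ => Nat.zero_le _) (Finset.mem_univ c)
    have h1 := one_le_projHeight y
    refine (hCle c y h).trans ?_
    gcongr
    exact zero_le_one.trans ((hC c).trans hCc)

end Height

/-! ### Points in homogeneous coordinates -/

section Coordinates

theorem MvPolynomial.IsHomogeneous.eval_smul {σ R : Type*} [CommSemiring R]
    {f : MvPolynomial σ R} {d : ℕ} (hf : f.IsHomogeneous d) (a : R) (v : σ → R) :
    eval (a • v) f = a ^ d * eval v f := by
  rw [eval_eq, eval_eq, Finset.mul_sum]
  refine Finset.sum_congr rfl fun e he => ?_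
  have hd : ∑ i ∈ e.support, e i = d := by
    rw [← hf (mem_support_iff.mp he), Finsupp.weight_apply, Finsupp.sum]
    simp
  simp only [Pi.smul_apply, smul_eq_mul, mul_pow, Finset.prod_mul_distrib,
    Finset.prod_pow_eq_pow_sum, hd]
  ring

variable {k L : Type} [Field k] [Field L] [Algebra k L]

theorem mk_mem_projZeroLocus_iff {n : ℕ} {S : Set (MvPolynomial (Fin (n + 1)) k)}
    (hS : ∀ f ∈ S, ∃ e, f.IsHomogeneous e) (v : Fin (n + 1) → L) (hv : v ≠ 0) :
    Projectivization.mk L v hv ∈ projZeroLocus k S L ↔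
      ∀ f ∈ S, eval v (map (algebraMap k L) f) = 0 := by
  obtain ⟨a, ha⟩ := Projectivization.exists_smul_eq_mk_rep L v hv
  refine forall₂_congr fun f hf => ?_
  obtain ⟨e, he⟩ := hS f hf
  rw [← ha, Units.smul_def, (he.map (algebraMap k L)).eval_smul, mul_eq_zero_iff_left]
  exact pow_ne_zero _ a.ne_zero

theorem ChartMap.evalVec_smul {m n : ℕ} (Φ : ChartMap k m n) (c : Fin Φ.numCharts) (a : L)
    (v : Fin (m + 1) → L) : Φ.evalVec c (a • v) = a ^ Φ.deg c • Φ.evalVec c v :=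
  funext fun i => ((Φ.homog c i).map (algebraMap k L)).eval_smul a v

theorem chartImage_mk_mk {m n : ℕ} (Φ : ChartMap k m n) (c : Fin Φ.numCharts)
    {v : Fin (m + 1) → L} (hv : v ≠ 0) {w : Fin (n + 1) → L} (hw : w ≠ 0) {a : L} (ha : a ≠ 0)
    (h : Φ.evalVec c v = a • w) :
    chartImage Φ (Projectivization.mk L v hv) (Projectivization.mk L w hw) := by
  obtain ⟨b, hb⟩ := Projectivization.exists_smul_eq_mk_rep L v hv
  have hrep : Φ.evalVec c (Projectivization.mk L v hv).rep =
      ((b : L) ^ Φ.deg c * a) • w := by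
    rw [← hb, Units.smul_def, Φ.evalVec_smul, h, smul_smul]
  have hne : (b : L) ^ Φ.deg c * a ≠ 0 := mul_ne_zero (pow_ne_zero _ b.ne_zero) ha
  refine ⟨c, ?_, ?_⟩
  · rw [hrep]
    exact smul_ne_zero hne hw
  · rw [eq_comm, Projectivization.mk_eq_mk_iff']
    exact ⟨_, hrep.symm⟩

theorem chartImage.exists_evalVec_eq_smul {m n : ℕ} {Φ : ChartMap k m n}
    {y : Projectivization L (Fin (m + 1) → L)} {x : Projectivization L (Fin (n + 1) → L)}
    (h : chartImage Φ y x) : ∃ c, ∃ a : L, a ≠ 0 ∧ Φ.evalVec c y.rep = a • x.rep := by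
  obtain ⟨c, hc, rfl⟩ := h
  obtain ⟨a, ha⟩ := Projectivization.exists_smul_eq_mk_rep L _ hc
  refine ⟨c, ((a⁻¹ : Lˣ) : L), Units.ne_zero _, ?_⟩
  rw [← ha, ← Units.smul_def, inv_smul_smul]

theorem Projectivization.mk_eq_mk_iff_forall_mul_eq_mul {K ι : Type*} [Field K] {v w : ι → K}
    (hv : v ≠ 0) (hw : w ≠ 0) :
    Projectivization.mk K v hv = Projectivization.mk K w hw ↔
      ∀ i j, v i * w j = v j * w i := by
  rw [Projectivization.mk_eq_mk_iff']
  constructor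
  · rintro ⟨a, rfl⟩ i j
    simp only [Pi.smul_apply, smul_eq_mul]
    ring
  · intro h
    obtain ⟨j, hj⟩ := Function.ne_iff.mp hw
    have hj : w j ≠ 0 := hj
    refine ⟨v j / w j, funext fun i => ?_⟩
    rw [Pi.smul_apply, smul_eq_mul, div_mul_eq_mul_div, div_eq_iff hj, h i j]

end Coordinates

/-! ### Uniform boundedness of finite fibers -/

section Ultraproduct

open Filter

/-- A sequence space over a field maps to an algebraically closed field, with kernel the sequences
vanishing along the given ultrafilter. -/
theorem exists_ringHom_isAlgClosed (L : Type) [Field L] (φ : Ultrafilter ℕ) :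
    ∃ (Ω : Type) (_ : Field Ω) (_ : IsAlgClosed Ω) (ψ : (ℕ → L) →+* Ω),
      ∀ a, ψ a = 0 ↔ ∀ᶠ N in (φ : Filter ℕ), a N = 0 := by
  refine ⟨AlgebraicClosure (Germ (φ : Filter ℕ) L), inferInstance, inferInstance,
    (algebraMap (Germ (φ : Filter ℕ) L) _).comp (Germ.coeRingHom (φ : Filter ℕ)), fun a => ?_⟩
  rw [RingHom.comp_apply, map_eq_zero_iff _ (RingHom.injective _)]
  exact Germ.coe_eq

variable {k L : Type} [Field k] [Field L] [Algebra k L] {m n : ℕ}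

/-- If the fibers over the geometric points of `X ∖ Z(SU)` are finite, then the cardinality of the
fibers over its `L`-points is bounded. -/
theorem exists_card_fiber_le
    {SY : Set (MvPolynomial (Fin (m + 1)) k)} {SX SU : Set (MvPolynomial (Fin (n + 1)) k)}
    (hSYhom : ∀ f ∈ SY, ∃ e, f.IsHomogeneous e)
    (hSXhom : ∀ f ∈ SX, ∃ e, f.IsHomogeneous e)
    (hSUhom : ∀ f ∈ SU, ∃ e, f.IsHomogeneous e)
    (Φ : ChartMap k m n)
    (hfin : ∀ (Ω : Type) [Field Ω] [Algebra k Ω] [IsAlgClosed Ω],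
      ∀ x ∈ projZeroLocus k SX Ω \ projZeroLocus k SU Ω,
        {y | y ∈ projZeroLocus k SY Ω ∧ chartImage Φ y x}.Finite) :
    ∃ B : ℕ, ∀ x ∈ projZeroLocus k SX L \ projZeroLocus k SU L,
      ∀ t : Finset (Projectivization L (Fin (m + 1) → L)),
        (∀ y ∈ t, y ∈ projZeroLocus k SY L ∧ chartImage Φ y x) → t.card ≤ B := by
  by_contra! hcon
  choose x hx t ht htcard using hcon
  have henum (N : ℕ) : ∃ e : ℕ → Projectivization L (Fin (m + 1) → L),
      Set.InjOn e (Set.Iio N) ∧ ∀ i < N, e i ∈ t N := by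
    have hpos : (t N).Nonempty := Finset.card_pos.mp ((Nat.zero_le N).trans_lt (htcard N))
    let g := (t N).equivFin.symm
    refine ⟨fun i => if h : i < (t N).card then g ⟨i, h⟩ else hpos.choose, ?_, ?_⟩
    · intro i hi j hj hij
      have hi' : i < (t N).card := lt_trans hi (htcard N)
      have hj' : j < (t N).card := lt_trans hj (htcard N)
      simp only [hi', hj', dif_pos] at hij
      simpa using g.injective (Subtype.ext hij)
    · intro i hi
      simp only [hi.trans (htcard N), dif_pos]
      exact (g _).2
  choose e hinj hmem using henum
  obtain ⟨Ω, _, _, ψ, hψ⟩ := exists_ringHom_isAlgClosed L (hyperfilter ℕ)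
  let _ : Algebra k Ω := (ψ.comp (algebraMap k (ℕ → L))).toAlgebra
  have hlt (i : ℕ) : ∀ᶠ N in (hyperfilter ℕ : Filter ℕ), i < N :=
    (Nat.hyperfilter_le_atTop : _ ≤ atTop) (eventually_gt_atTop i)
  have heval {r : ℕ} (v : ℕ → Fin r → L) (f : MvPolynomial (Fin r) k) :
      eval (fun j => ψ fun N => v N j) (map (algebraMap k Ω) f) =
        ψ fun N => eval (v N) (map (algebraMap k L) f) := by
    induction f using MvPolynomial.induction_on with
    | C a =>
      simp only [map_C, eval_C]
      rfl
    | add p q hp hq =>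
      simp only [map_add, hp, hq]
      rw [← map_add]
      rfl
    | mul_X p i hp =>
      simp only [map_mul, hp, map_X, eval_X]
      rw [← map_mul]
      rfl
  have hne {r : ℕ} (v : ℕ → Projectivization L (Fin r → L)) :
      (fun j => ψ fun N => (v N).rep j) ≠ 0 := by
    intro h
    have h' : ∀ᶠ N in (hyperfilter ℕ : Filter ℕ), ∀ j, (v N).rep j = 0 :=
      eventually_all.mpr fun j => (hψ _).mp (congrFun h j)
    obtain ⟨N, hN⟩ := h'.exists
    exact (v N).rep_nonzero (funext hN)
  have hX : Projectivization.mk Ω _ (hne x) ∈ projZeroLocus k SX Ω \ projZeroLocus k SU Ω := by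
    constructor
    · rw [mk_mem_projZeroLocus_iff hSXhom]
      intro f hf
      rw [heval, hψ]
      exact Eventually.of_forall fun N => (hx N).1 f hf
    · rw [mk_mem_projZeroLocus_iff hSUhom]
      intro hall
      obtain ⟨T, hTS, hT⟩ := (Submodule.fg_span_iff_fg_span_finset_subset SU).mp
        (IsNoetherian.noetherian (Ideal.span SU))
      have hev : ∀ᶠ N in (hyperfilter ℕ : Filter ℕ), ∀ f ∈ T,
          eval (x N).rep (map (algebraMap k L) f) = 0 := by
        rw [Finset.eventually_all]
        intro f hf
        rw [← hψ, ← heval]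
        exact hall f (hTS hf)
      obtain ⟨N, hN⟩ := hev.exists
      refine (hx N).2 fun f hf => ?_
      have hle : Ideal.span (T : Set (MvPolynomial (Fin (n + 1)) k)) ≤
          RingHom.ker ((eval (x N).rep).comp (map (algebraMap k L))) :=
        Ideal.span_le.mpr hN
      exact hle (hT.le (Ideal.subset_span hf))
  suffices h : Function.Injective (fun i => Projectivization.mk Ω _ (hne fun N => e N i)) ∧
      ∀ i, Projectivization.mk Ω _ (hne fun N => e N i) ∈
        {y | y ∈ projZeroLocus k SY Ω ∧ chartImage Φ y (Projectivization.mk Ω _ (hne x))} from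
    Set.infinite_of_injective_forall_mem h.1 h.2 (hfin Ω _ hX)
  refine ⟨?_, fun i => ⟨?_, ?_⟩⟩
  · intro i i' h
    rw [Projectivization.mk_eq_mk_iff_forall_mul_eq_mul] at h
    have hev : ∀ᶠ N in (hyperfilter ℕ : Filter ℕ), ∀ j l,
        (e N i).rep j * (e N i').rep l = (e N i).rep l * (e N i').rep j := by
      refine eventually_all.mpr fun j => eventually_all.mpr fun l => ?_
      have := sub_eq_zero.mpr (h j l)
      rw [← map_mul, ← map_mul, ← map_sub, hψ] at this
      exact this.mono fun N hN => sub_eq_zero.mp hN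
    obtain ⟨N, hN, hi, hi'⟩ := (hev.and ((hlt i).and (hlt i'))).exists
    refine hinj N hi hi' ?_
    rw [← (e N i).mk_rep, ← (e N i').mk_rep,
      Projectivization.mk_eq_mk_iff_forall_mul_eq_mul]
    exact hN
  · rw [mk_mem_projZeroLocus_iff hSYhom]
    intro f hf
    rw [heval, hψ]
    exact (hlt i).mono fun N hN => (ht N _ (hmem N i hN)).1 f hf
  · have hch (N : ℕ) : ∃ a : L, a ≠ 0 ∧ (i < N → ∃ c,
        Φ.evalVec c (e N i).rep = a • (x N).rep) := by
      by_cases hN : i < N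
      · obtain ⟨c, a, ha, h⟩ := (ht N _ (hmem N i hN)).2.exists_evalVec_eq_smul
        exact ⟨a, ha, fun _ => ⟨c, h⟩⟩
      · exact ⟨1, one_ne_zero, fun h => absurd h hN⟩
    choose a ha hac using hch
    obtain ⟨c, hc⟩ := Ultrafilter.eventually_exists_iff.mp ((hlt i).mono hac)
    refine chartImage_mk_mk Φ c _ _ (a := ψ a) ?_ ?_
    · rw [Ne, hψ]
      intro h
      obtain ⟨N, hN⟩ := h.exists
      exact ha N hN
    · funext j
      rw [Pi.smul_apply, smul_eq_mul, ← map_mul, ← sub_eq_zero]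
      refine (congrArg (· - _) (heval (fun N => (e N i).rep) (Φ.F c j))).trans ?_
      rw [← map_sub, hψ]
      exact hc.mono fun N hN => sub_eq_zero.mpr (congrFun hN j)

end Ultraproduct

/-! ### Sparsity and maps with bounded fibers -/

/-- Sparsity pulls back along correspondences with bounded fibers that increase heights at most
polynomially. -/
theorem IsSparseWrt.of_bounded_fibers {P Q : Type} {S : Set P} {R : Set Q} {H : P → ℝ}
    {G : Q → ℝ} (hS : IsSparseWrt S H) (r : Q → P → Prop) {C : ℝ} {D B : ℕ} (hC : 1 ≤ C)
    (hG : ∀ y ∈ R, 0 ≤ G y)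
    (hR : ∀ y ∈ R, ∃ x ∈ S, r y x ∧ H x ≤ C * G y ^ D)
    (hB : ∀ x ∈ S, ∀ t : Finset Q, (∀ y ∈ t, y ∈ R ∧ r y x) → t.card ≤ B) :
    IsSparseWrt R G := by
  classical
  intro ε hε
  have hδ : 0 < ε / (D + 1) := by positivity
  obtain ⟨C', hC', hcount⟩ := hS (ε / (D + 1)) hδ
  have hC0 : 0 < C := zero_lt_one.trans_le hC
  refine ⟨C' * C ^ (ε / (D + 1)) * (B + 1), by positivity, fun T hT => ?_⟩
  have hT0 : 0 < T := zero_lt_one.trans_le hT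
  obtain ⟨hfinS, hcardS⟩ := hcount (C * T ^ D) (one_le_mul_of_one_le_of_one_le hC
    (one_le_pow₀ hT))
  have hfiber (x : P) (hx : x ∈ S) : {y | y ∈ R ∧ r y x}.Finite := by
    by_contra hinf
    obtain ⟨t, hts, htc⟩ := Set.Infinite.exists_subset_card_eq hinf (B + 1)
    have := hB x hx t fun y hy => hts hy
    omega
  have hsub : {y | y ∈ R ∧ G y ≤ T} ⊆
      ⋃ x ∈ {x | x ∈ S ∧ H x ≤ C * T ^ D}, {y | y ∈ R ∧ r y x} := by
    rintro y ⟨hy, hyT⟩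
    obtain ⟨x, hx, hyx, hHx⟩ := hR y hy
    refine Set.mem_biUnion (x := x) ⟨hx, hHx.trans ?_⟩ ⟨hy, hyx⟩
    have := hG y hy
    gcongr
  have hfinU := hfinS.biUnion fun x hx => hfiber x hx.1
  have hfinR := hfinU.subset hsub
  refine ⟨hfinR, ?_⟩
  have hcard : {y | y ∈ R ∧ G y ≤ T}.ncard ≤ {x | x ∈ S ∧ H x ≤ C * T ^ D}.ncard * B := by
    rw [Set.ncard_eq_toFinset_card _ hfinR, Set.ncard_eq_toFinset_card _ hfinS]
    let F : P → Finset Q := fun x => hfinR.toFinset.filter fun y => r y x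
    have hF : hfinR.toFinset ⊆ hfinS.toFinset.biUnion F := by
      intro y hy
      obtain ⟨x, hx, hyx⟩ := Set.mem_iUnion₂.mp (hsub (hfinR.mem_toFinset.mp hy))
      exact Finset.mem_biUnion.mpr ⟨x, hfinS.mem_toFinset.mpr hx,
        Finset.mem_filter.mpr ⟨hy, hyx.2⟩⟩
    refine (Finset.card_le_card hF).trans (Finset.card_biUnion_le_card_mul _ _ _ fun x hx => ?_)
    refine hB x (hfinS.mem_toFinset.mp hx).1 _ fun y hy => ?_
    obtain ⟨hy, hyx⟩ := Finset.mem_filter.mp hy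
    exact ⟨(hfinR.mem_toFinset.mp hy).1, hyx⟩
  calc
    ({y | y ∈ R ∧ G y ≤ T}.ncard : ℝ)
        ≤ ({x | x ∈ S ∧ H x ≤ C * T ^ D}.ncard : ℝ) * B := mod_cast hcard
    _ ≤ C' * (C * T ^ D) ^ (ε / (D + 1)) * (B + 1) := by
      gcongr
      linarith
    _ = C' * C ^ (ε / (D + 1)) * (B + 1) * (T ^ D) ^ (ε / (D + 1)) := by
      rw [Real.mul_rpow hC0.le (by positivity)]
      ring
    _ ≤ C' * C ^ (ε / (D + 1)) * (B + 1) * T ^ ε := by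
      gcongr
      rw [← Real.rpow_natCast, ← Real.rpow_mul hT0.le]
      refine Real.rpow_le_rpow_of_exponent_le hT ?_
      rw [mul_div_assoc', div_le_iff₀ (by positivity)]
      nlinarith

/-- Let `f : Y → X` be a morphism of projective geometrically
irreducible varieties over a number field `k` (realized as closed subvarieties of
projective spaces, the morphism being given by polynomial chart data `Φ`).  Let
`U = X ∖ Z(SU)` be a Zariski open subset of `X` and `V = f⁻¹(U)`, and assume that
`f|_V : V → U` is finite (for a morphism of projective varieties restricted over an open
subset, this is equivalent to having finite fibers over the geometric points of `U`).
If `U` is xeric, then `V` is xeric. -/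
theorem statement_4 (k : Type) [Field k] [NumberField k] (m n : ℕ)
    (SY : Set (MvPolynomial (Fin (m + 1)) k)) (SX SU : Set (MvPolynomial (Fin (n + 1)) k))
    (hSYhom : ∀ f ∈ SY, ∃ e, f.IsHomogeneous e)
    (hSXhom : ∀ f ∈ SX, ∃ e, f.IsHomogeneous e)
    (hSUhom : ∀ f ∈ SU, ∃ e, f.IsHomogeneous e)
    (hYint : GeomIntegralOver k (AlgebraicClosure k) SY)
    (hXint : GeomIntegralOver k (AlgebraicClosure k) SX)
    (Φ : ChartMap k m n) (hmor : IsChartMorphism k Φ SY SX)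
    (hfin : ∀ (Ω : Type) [Field Ω] [Algebra k Ω] [IsAlgClosed Ω],
      ∀ x ∈ projZeroLocus k SX Ω \ projZeroLocus k SU Ω,
        {y | y ∈ projZeroLocus k SY Ω ∧ chartImage Φ y x}.Finite)
    (hU : ∀ (L : Type) [Field L] [NumberField L] [Algebra k L] [FiniteDimensional k L],
      IsSparseWrt (projZeroLocus k SX L \ projZeroLocus k SU L) projHeight) :
    ∀ (L : Type) [Field L] [NumberField L] [Algebra k L] [FiniteDimensional k L],
      IsSparseWrt
        {y | y ∈ projZeroLocus k SY L ∧
          ∃ x, chartImage Φ y x ∧ x ∈ projZeroLocus k SX L \ projZeroLocus k SU L}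
        projHeight := by
  intro L _ _ _ _
  obtain ⟨C, D, hC, hCle⟩ := exists_projHeight_chartImage_le (K := L) Φ
  obtain ⟨B, hB⟩ := exists_card_fiber_le (L := L) hSYhom hSXhom hSUhom Φ hfin
  refine (hU L).of_bounded_fibers (chartImage Φ) (D := D) hC
    (fun y _ => zero_le_one.trans (one_le_projHeight y)) ?_
    (fun x hx t ht => hB x hx t fun y hy => ⟨(ht y hy).1.1, (ht y hy).2⟩)
  rintro y ⟨-, x, hyx, hx⟩
  exact ⟨x, hx, hyx, hCle y x hyx⟩
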